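/- Let d ≥ 1 be an integer and let w : ℕ → [0,∞) satisfy w(0) ≥ 1. Then the following are equivalent: (i) F_w^(d) contains a function that is not λ_d-almost everywhere constant; (ii) ∑_{j=1}^∞ 2^{−dj}·⌊w(j)⌋ ≥ 1. -/

import Mathlib

open MeasureTheory Set
open scoped ENNReal

noncomputable section

/-- Points of `ℝ^d`. -/
abbrev Pt (d : ℕ) : Type := Fin d → ℝ

/-- The unit cube `[0,1]^d`. -/
def unitCube (d : ℕ) : Set (Pt d) := Set.Icc 0 1

/-- Lebesgue measure `λ_d` on `[0,1]^d`. -/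
def lamd (d : ℕ) : Measure (Pt d) := volume.restrict (unitCube d)

/-- The dyadic subinterval of `[0,1]` at level `j` with index `k`:
`[k 2^{-j}, (k+1) 2^{-j})` for `k < 2^j - 1` and `[1 - 2^{-j}, 1]` for `k = 2^j - 1`. -/
def dyadicI (j k : ℕ) : Set ℝ :=
  if k = 2 ^ j - 1 then Set.Icc (1 - ((2 : ℝ) ^ j)⁻¹) 1
  else Set.Ico ((k : ℝ) / 2 ^ j) (((k : ℝ) + 1) / 2 ^ j)

/-- The dyadic cube `I_k^{(j)} ⊆ [0,1]^d` at level `j` with multi-index `k`. -/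
def dyadicCube (d j : ℕ) (k : Fin d → ℕ) : Set (Pt d) :=
  {x | ∀ i, x i ∈ dyadicI j (k i)}

/-- `f` is represented by the (automatically countable) family `T` of pairwise disjoint
dyadic cubes whose union has full Lebesgue measure in `[0,1]^d`, with `f` constant
on each cube of the family. -/
def IsDyadicRep (d : ℕ) (f : Pt d → ℝ) (T : Set (ℕ × (Fin d → ℕ))) : Prop :=
  (∀ p ∈ T, ∀ i, p.2 i < 2 ^ p.1) ∧
  (T.PairwiseDisjoint fun p => dyadicCube d p.1 p.2) ∧
  lamd d (unitCube d \ ⋃ p ∈ T, dyadicCube d p.1 p.2) = 0 ∧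
  (∀ p ∈ T, ∀ x ∈ dyadicCube d p.1 p.2, ∀ y ∈ dyadicCube d p.1 p.2, f x = f y)

/-- The class `F^(d)` of measurable `{-1,1}`-valued functions admitting a dyadic
representation. -/
def memF (d : ℕ) (f : Pt d → ℝ) : Prop :=
  Measurable f ∧ (∀ x, f x = 1 ∨ f x = -1) ∧ ∃ T, IsDyadicRep d f T

/-- The class `F_w^(d)`: a dyadic representation with at most `w j` cubes of side
`2^{-j}` for every level `j`. -/
def memFw (d : ℕ) (w : ℕ → ℝ) (f : Pt d → ℝ) : Prop :=
  Measurable f ∧ (∀ x, f x = 1 ∨ f x = -1) ∧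
    ∃ T, IsDyadicRep d f T ∧
      ∀ j, ((T ∩ {p | p.1 = j}).encard : ℝ≥0∞) ≤ ENNReal.ofReal (w j)

/-- Marginal `P^X` of `π` on `[0,1]^d`. -/
def margX {d : ℕ} (π : Measure (Pt d × ℝ)) : Measure (Pt d) := π.map Prod.fst

/-- The labels of `π` lie in `{-1, 1}` almost surely. -/
def Labels {d : ℕ} (π : Measure (Pt d × ℝ)) : Prop := π {p | p.2 = 1 ∨ p.2 = -1} = 1

/-- `η` is the regression function (conditional probability of `Y = 1`) of `π`. -/
def IsRegression {d : ℕ} (π : Measure (Pt d × ℝ)) (η : Pt d → ℝ) : Prop :=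
  Measurable η ∧ (∀ x, η x ∈ Set.Icc (0 : ℝ) 1) ∧
    ∀ s : Set (Pt d), MeasurableSet s →
      π (s ×ˢ {(1 : ℝ)}) = ∫⁻ x in s, ENNReal.ofReal (η x) ∂(margX π)

/-- The Bayes rule `f*` associated with the regression function `η`. -/
def bayes {d : ℕ} (η : Pt d → ℝ) (x : Pt d) : ℝ := if 1 / 2 ≤ η x then 1 else -1

/-- Misclassification risk `R(f) = π({(x,y) : f(x) ≠ y})`. -/
def risk {d : ℕ} (π : Measure (Pt d × ℝ)) (f : Pt d → ℝ) : ℝ :=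
  (π {p | f p.1 ≠ p.2}).toReal

/-- Assumption (A1): `P^X` is absolutely continuous w.r.t. `λ_d` with density
between `a` and `A`. -/
def A1cond {d : ℕ} (π : Measure (Pt d × ℝ)) (a A : ℝ) : Prop :=
  ∀ s : Set (Pt d), MeasurableSet s →
    ENNReal.ofReal a * lamd d s ≤ margX π s ∧ margX π s ≤ ENNReal.ofReal A * lamd d s

/-- Strong margin assumption (SMA) with margin `h`. -/
def SMAcond {d : ℕ} (π : Measure (Pt d × ℝ)) (η : Pt d → ℝ) (h : ℝ) : Prop :=
  margX π {x | h ≤ |2 * η x - 1|} = 1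

/-- Number of indices `i` satisfying `P i`. -/
def cnt (n : ℕ) (P : Fin n → Prop) : ℕ := Nat.card {i // P i}

/-- Index of the level-`J` dyadic interval containing `t ∈ [0,1]`. -/
def dyadicIdx (J : ℕ) (t : ℝ) : ℕ := min ⌊t * 2 ^ J⌋₊ (2 ^ J - 1)

/-- The level-`J` dyadic cube containing `x ∈ [0,1]^d`. -/
def cubeOf (d J : ℕ) (x : Pt d) : Set (Pt d) := dyadicCube d J fun i => dyadicIdx J (x i)

open Classical in
/-- The dyadic majority-vote classifier `f̂_n^{(J)}` built from the sample `s`. -/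
def fhat (d J n : ℕ) (s : Fin n → Pt d × ℝ) (x : Pt d) : ℝ :=
  if (∃ i, (s i).1 ∈ cubeOf d J x) ∧
      cnt n (fun i => (s i).1 ∈ cubeOf d J x ∧ (s i).2 = -1) <
        cnt n (fun i => (s i).1 ∈ cubeOf d J x ∧ (s i).2 = 1)
  then 1 else -1

/-- The `n`-fold product measure `π^{⊗n}` governing the i.i.d. sample. -/
def sampM {d : ℕ} (π : Measure (Pt d × ℝ)) [SigmaFinite π] (n : ℕ) :
    Measure (Fin n → Pt d × ℝ) := Measure.pi fun _ => π

/-- Expected excess risk `E_{π^{⊗n}}[R(f̂_n) - R(f*)]` of the classifier `F`. -/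
def excessExp {d : ℕ} (π : Measure (Pt d × ℝ)) [SigmaFinite π] (η : Pt d → ℝ) (n : ℕ)
    (F : (Fin n → Pt d × ℝ) → Pt d → ℝ) : ℝ :=
  ∫ s, risk π (F s) ∂(sampM π n) - risk π (bayes η)

/-- The class `P_{w,h,a,A}` of probability measures (together with their regression
functions) satisfying (A1), (SMA), and whose Bayes rule belongs to `F_w^(d)`. -/
def Pclass (d : ℕ) (w : ℕ → ℝ) (h a A : ℝ) :
    Set (ProbabilityMeasure (Pt d × ℝ) × (Pt d → ℝ)) :=
  {p | Labels (p.1 : Measure (Pt d × ℝ)) ∧ IsRegression (p.1 : Measure (Pt d × ℝ)) p.2 ∧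
       A1cond (p.1 : Measure (Pt d × ℝ)) a A ∧ SMAcond (p.1 : Measure (Pt d × ℝ)) p.2 h ∧
       memFw d w (bayes p.2)}

end
section DyadicGeometry

lemma dyadicIdx_lt (j : ℕ) (t : ℝ) : dyadicIdx j t < 2 ^ j := by
  have : 0 < 2 ^ j := by positivity
  unfold dyadicIdx
  omega

lemma dyadicIdx_succ_div_two (j : ℕ) (t : ℝ) :
    dyadicIdx (j + 1) t / 2 = dyadicIdx j t := by
  have h : ⌊t * 2 ^ j⌋₊ = ⌊t * 2 ^ (j + 1)⌋₊ / 2 := by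
    rw [← Nat.floor_div_natCast]
    congr 1
    push_cast
    ring
  have : 0 < 2 ^ j := by positivity
  unfold dyadicIdx
  rw [h, pow_succ 2 j]
  omega

lemma mem_dyadicI_iff {j k : ℕ} (hk : k < 2 ^ j) (t : ℝ) :
    t ∈ dyadicI j k ↔ t ∈ Set.Icc (0 : ℝ) 1 ∧ dyadicIdx j t = k := by
  have hN : (0 : ℝ) < 2 ^ j := by positivity
  have hk' : (k : ℝ) + 1 ≤ 2 ^ j := by exact_mod_cast hk
  unfold dyadicI dyadicIdx
  split_ifs with h
  · have hkN : (k : ℝ) + 1 = 2 ^ j := by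
      have : k + 1 = 2 ^ j := by omega
      exact_mod_cast this
    have hlow : 1 - ((2 : ℝ) ^ j)⁻¹ = k / 2 ^ j := by
      rw [← hkN]
      field_simp
      ring
    rw [hlow, ← h, min_eq_right_iff, mem_Icc, mem_Icc, div_le_iff₀ hN]
    constructor
    · rintro ⟨h1, h2⟩
      refine ⟨⟨?_, h2⟩, Nat.le_floor h1⟩
      by_contra! h0
      nlinarith [(Nat.cast_nonneg k : (0 : ℝ) ≤ k)]
    · rintro ⟨⟨h0, h2⟩, h1⟩
      exact ⟨(Nat.le_floor_iff (by positivity)).1 h1, h2⟩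
  · have hlt : k < 2 ^ j - 1 := by omega
    rw [mem_Ico, mem_Icc, div_le_iff₀ hN, lt_div_iff₀ hN]
    constructor
    · rintro ⟨h1, h2⟩
      have h0 : 0 ≤ t := by
        by_contra! h0
        nlinarith [(Nat.cast_nonneg k : (0 : ℝ) ≤ k)]
      have hfl : ⌊t * 2 ^ j⌋₊ = k := (Nat.floor_eq_iff (by positivity)).2 ⟨h1, h2⟩
      exact ⟨⟨h0, by by_contra! h3; nlinarith⟩, by omega⟩
    · rintro ⟨⟨h0, -⟩, h1⟩
      have hfl : ⌊t * 2 ^ j⌋₊ = k := by omega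
      exact (Nat.floor_eq_iff (by positivity)).1 hfl

lemma measurableSet_dyadicI (j k : ℕ) : MeasurableSet (dyadicI j k) := by
  unfold dyadicI
  split_ifs
  exacts [measurableSet_Icc, measurableSet_Ico]

lemma volume_dyadicI (j k : ℕ) : volume (dyadicI j k) = ((2 : ℝ≥0∞) ^ j)⁻¹ := by
  have h : ENNReal.ofReal ((2 : ℝ) ^ j)⁻¹ = ((2 : ℝ≥0∞) ^ j)⁻¹ := by
    rw [ENNReal.ofReal_inv_of_pos (by positivity), ENNReal.ofReal_pow (by norm_num)]
    simp
  rw [← h]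
  unfold dyadicI
  split_ifs
  · rw [Real.volume_Icc]
    congr 1
    ring
  · rw [Real.volume_Ico]
    congr 1
    ring

variable {d : ℕ}

lemma dyadicCube_eq_pi (j : ℕ) (k : Fin d → ℕ) :
    dyadicCube d j k = Set.univ.pi fun i => dyadicI j (k i) := by
  ext x
  simp [dyadicCube]

lemma measurableSet_dyadicCube (j : ℕ) (k : Fin d → ℕ) : MeasurableSet (dyadicCube d j k) := by
  rw [dyadicCube_eq_pi]
  exact MeasurableSet.univ_pi fun i => measurableSet_dyadicI _ _

lemma volume_dyadicCube (j : ℕ) (k : Fin d → ℕ) :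
    volume (dyadicCube d j k) = ((2 : ℝ≥0∞) ^ (d * j))⁻¹ := by
  rw [dyadicCube_eq_pi, volume_pi_pi]
  simp [volume_dyadicI, ENNReal.inv_pow, ← pow_mul, mul_comm]

lemma mem_dyadicCube_iff {j : ℕ} {k : Fin d → ℕ} (hk : ∀ i, k i < 2 ^ j) (x : Pt d) :
    x ∈ dyadicCube d j k ↔ x ∈ unitCube d ∧ (fun i => dyadicIdx j (x i)) = k := by
  simp only [dyadicCube, unitCube, mem_ofPred_eq, mem_dyadicI_iff (hk _), mem_Icc, Pi.le_def,
    funext_iff, Pi.zero_apply, Pi.one_apply, forall_and]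

lemma lamd_le_volume (s : Set (Pt d)) : lamd d s ≤ volume s := Measure.restrict_apply_le _ _

lemma lamd_dyadicCube {j : ℕ} {k : Fin d → ℕ} (hk : ∀ i, k i < 2 ^ j) :
    lamd d (dyadicCube d j k) = ((2 : ℝ≥0∞) ^ (d * j))⁻¹ := by
  rw [lamd, Measure.restrict_eq_self _ fun x hx => ((mem_dyadicCube_iff hk x).1 hx).1,
    volume_dyadicCube]

lemma lamd_unitCube : lamd d (unitCube d) = 1 := by
  simp [lamd, unitCube, Real.volume_Icc_pi]

instance : IsProbabilityMeasure (lamd d) :=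
  ⟨by simp [lamd, unitCube, Real.volume_Icc_pi]⟩

lemma ae_mem_unitCube : ∀ᵐ x ∂(lamd d), x ∈ unitCube d :=
  ae_restrict_mem measurableSet_Icc

lemma lamd_biUnion_dyadicCube_le (j : ℕ) (A : Finset (Fin d → ℕ)) :
    lamd d (⋃ k ∈ A, dyadicCube d j k) ≤ ((2 : ℝ≥0∞) ^ (d * j))⁻¹ * A.card := by
  refine (measure_biUnion_finset_le _ _).trans ?_
  refine (Finset.sum_le_sum fun k _ => (lamd_le_volume _).trans (volume_dyadicCube j k).le).trans ?_
  simp [mul_comm]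

end DyadicGeometry

section Necessity

variable {d : ℕ} {w : ℕ → ℝ} {f : Pt d → ℝ} {T : Set (ℕ × (Fin d → ℕ))}

lemma IsDyadicRep.ae_eq_const_of_level_zero (hT : IsDyadicRep d f T) {k : Fin d → ℕ}
    (hk : ((0, k) : ℕ × (Fin d → ℕ)) ∈ T) : ∀ᵐ x ∂(lamd d), f x = f 0 := by
  obtain ⟨hlt, -, -, hconst⟩ := hT
  have hmem : ∀ x ∈ unitCube d, x ∈ dyadicCube d 0 k := fun x hx => by
    refine (mem_dyadicCube_iff (hlt _ hk) x).2 ⟨hx, funext fun i => ?_⟩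
    have h1 := dyadicIdx_lt 0 (x i)
    have h2 := hlt _ hk i
    simp only [pow_zero, Nat.lt_one_iff] at h1 h2
    exact h1.trans h2.symm
  filter_upwards [ae_mem_unitCube] with x hx
  exact hconst _ hk x (hmem x hx) 0 (hmem 0 (by simp [unitCube]))

lemma exists_finset_level (hw : ∀ j, 0 ≤ w j)
    (hc : ∀ j, ((T ∩ {p | p.1 = j}).encard : ℝ≥0∞) ≤ ENNReal.ofReal (w j)) (j : ℕ) :
    ∃ A : Finset (Fin d → ℕ), (∀ k, (j, k) ∈ T ↔ k ∈ A) ∧ A.card ≤ ⌊w j⌋₊ := by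
  have himg : T ∩ {p | p.1 = j} = Set.image (Prod.mk j) {k | (j, k) ∈ T} := by
    ext ⟨i, k⟩
    simp only [mem_inter_iff, mem_ofPred_eq, mem_image, Prod.mk.injEq]
    constructor
    · rintro ⟨h, rfl⟩
      exact ⟨k, h, rfl, rfl⟩
    · rintro ⟨k, h, rfl, rfl⟩
      exact ⟨h, rfl⟩
  have h := hc j
  rw [himg, (Prod.mk_right_injective j).encard_image] at h
  have hfin : {k | (j, k) ∈ T}.Finite := by
    by_contra hinf
    rw [Set.Infinite.encard_eq hinf] at h
    simp at h
  refine ⟨hfin.toFinset, fun k => by simp, Nat.le_floor ?_⟩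
  rw [hfin.encard_eq_coe_toFinset_card, ENat.toENNReal_coe, ← ENNReal.ofReal_natCast] at h
  exact (ENNReal.ofReal_le_ofReal_iff (hw j)).1 h

lemma one_le_tsum_of_memFw (hw : ∀ j, 0 ≤ w j) (hf : memFw d w f)
    (hnc : ∀ c : ℝ, ¬ (∀ᵐ x ∂(lamd d), f x = c)) :
    1 ≤ ∑' j : ℕ, ((2 : ℝ≥0∞) ^ (d * (j + 1)))⁻¹ * (⌊w (j + 1)⌋₊ : ℝ≥0∞) := by
  obtain ⟨-, -, T, hT, hc⟩ := hf
  choose A hA hcard using exists_finset_level hw hc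
  have hsub : (⋃ p ∈ T, dyadicCube d p.1 p.2) ⊆
      ⋃ j : ℕ, ⋃ k ∈ A (j + 1), dyadicCube d (j + 1) k := by
    refine iUnion₂_subset ?_
    rintro ⟨_ | j, k⟩ hp
    · exact absurd (hT.ae_eq_const_of_level_zero hp) (hnc _)
    · exact subset_iUnion_of_subset j (subset_iUnion₂_of_subset k ((hA _ _).1 hp) subset_rfl)
  calc (1 : ℝ≥0∞) = lamd d (unitCube d) := lamd_unitCube.symm
    _ ≤ lamd d (⋃ p ∈ T, dyadicCube d p.1 p.2) := by
        have := measure_le_inter_add_sdiff (lamd d) (unitCube d) (⋃ p ∈ T, dyadicCube d p.1 p.2)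
        rw [hT.2.2.1, add_zero] at this
        exact this.trans (measure_mono inter_subset_right)
    _ ≤ lamd d (⋃ j : ℕ, ⋃ k ∈ A (j + 1), dyadicCube d (j + 1) k) := measure_mono hsub
    _ ≤ ∑' j : ℕ, lamd d (⋃ k ∈ A (j + 1), dyadicCube d (j + 1) k) := measure_iUnion_le _
    _ ≤ _ := by
        refine ENNReal.tsum_le_tsum fun j => (lamd_biUnion_dyadicCube_le _ _).trans ?_
        gcongr
        exact hcard _

end Necessity

section GreedySelection

/-- Indices of the level-`(j + 1)` subcubes of the level-`j` cubes indexed by `A`. -/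
def dyadicChildren {d : ℕ} (j : ℕ) (A : Finset (Fin d → ℕ)) : Finset (Fin d → ℕ) :=
  (Fintype.piFinset fun _ => Finset.range (2 ^ (j + 1))).filter fun k => (fun i => k i / 2) ∈ A

lemma card_dyadicChildren_le {d : ℕ} (j : ℕ) (A : Finset (Fin d → ℕ)) :
    (dyadicChildren j A).card ≤ 2 ^ d * A.card := by
  have h : (A ×ˢ Fintype.piFinset fun _ : Fin d => Finset.range 2).card = 2 ^ d * A.card := by
    simp [mul_comm]
  rw [← h]
  refine Finset.card_le_card_of_injOn (fun k => (fun i => k i / 2, fun i => k i % 2)) ?_ ?_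
  · intro k hk
    have hk' := (Finset.mem_filter.1 hk).2
    simp only [Finset.coe_product, mem_prod, Finset.mem_coe, Fintype.mem_piFinset,
      Finset.mem_range]
    exact ⟨hk', fun i => Nat.mod_lt _ two_pos⟩
  · intro k _ l _ hkl
    simp only [Prod.mk.injEq, funext_iff] at hkl
    funext i
    have h1 := hkl.1 i
    have h2 := hkl.2 i
    omega

/-- `min m #B` elements of `B`. -/
noncomputable def takeUpTo {α : Type*} (m : ℕ) (B : Finset α) : Finset α :=
  (Finset.exists_subset_card_eq (min_le_right m B.card)).choose

lemma takeUpTo_subset {α : Type*} (m : ℕ) (B : Finset α) : takeUpTo m B ⊆ B :=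
  (Finset.exists_subset_card_eq (min_le_right m B.card)).choose_spec.1

lemma card_takeUpTo {α : Type*} (m : ℕ) (B : Finset α) : (takeUpTo m B).card = min m B.card :=
  (Finset.exists_subset_card_eq (min_le_right m B.card)).choose_spec.2

/-- Indices of the level-`j` cubes left uncovered when up to `m i` free cubes have been selected
at each level `1 ≤ i ≤ j`. -/
noncomputable def freeCubes (d : ℕ) (m : ℕ → ℕ) : ℕ → Finset (Fin d → ℕ)
  | 0 => {0}
  | j + 1 => dyadicChildren j (freeCubes d m j) \
      takeUpTo (m (j + 1)) (dyadicChildren j (freeCubes d m j))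

/-- Indices of the cubes selected greedily at level `j + 1`. -/
noncomputable def pickedCubes (d : ℕ) (m : ℕ → ℕ) (j : ℕ) : Finset (Fin d → ℕ) :=
  takeUpTo (m (j + 1)) (dyadicChildren j (freeCubes d m j))

/-- The greedily selected family of dyadic cubes. -/
def greedyFamily (d : ℕ) (m : ℕ → ℕ) : Set (ℕ × (Fin d → ℕ)) :=
  {p | ∃ j, p.1 = j + 1 ∧ p.2 ∈ pickedCubes d m j}

variable {d : ℕ} {m : ℕ → ℕ}

lemma freeCubes_succ (j : ℕ) : freeCubes d m (j + 1) =
    dyadicChildren j (freeCubes d m j) \ pickedCubes d m j := rfl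

lemma pickedCubes_subset (j : ℕ) :
    pickedCubes d m j ⊆ dyadicChildren j (freeCubes d m j) := takeUpTo_subset _ _

lemma lt_of_mem_pickedCubes {j : ℕ} {k : Fin d → ℕ} (hk : k ∈ pickedCubes d m j) (i : Fin d) :
    k i < 2 ^ (j + 1) := by
  have := (Finset.mem_filter.1 (pickedCubes_subset j hk)).1
  simpa using Fintype.mem_piFinset.1 this i

lemma idx_mem_dyadicChildren (j : ℕ) (A : Finset (Fin d → ℕ)) (x : Pt d) :
    (fun i => dyadicIdx (j + 1) (x i)) ∈ dyadicChildren j A ↔ (fun i => dyadicIdx j (x i)) ∈ A := by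
  simp [dyadicChildren, dyadicIdx_lt, dyadicIdx_succ_div_two]

lemma idx_mem_freeCubes_of_le {i j : ℕ} (hij : i ≤ j) {x : Pt d}
    (hx : (fun l => dyadicIdx j (x l)) ∈ freeCubes d m j) :
    (fun l => dyadicIdx i (x l)) ∈ freeCubes d m i := by
  induction j, hij using Nat.le_induction with
  | base => exact hx
  | succ j _ ih =>
    rw [freeCubes_succ, Finset.mem_sdiff, idx_mem_dyadicChildren] at hx
    exact ih hx.1

lemma idx_notMem_pickedCubes_of_lt {i j : ℕ} (hij : i < j) {x : Pt d}
    (hx : (fun l => dyadicIdx (i + 1) (x l)) ∈ pickedCubes d m i) :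
    (fun l => dyadicIdx (j + 1) (x l)) ∉ pickedCubes d m j := by
  intro h
  have h1 := (idx_mem_dyadicChildren j _ x).1 (pickedCubes_subset j h)
  have h2 := idx_mem_freeCubes_of_le (Nat.succ_le_of_lt hij) h1
  rw [freeCubes_succ, Finset.mem_sdiff] at h2
  exact h2.2 hx

lemma pairwiseDisjoint_greedyFamily :
    (greedyFamily d m).PairwiseDisjoint fun p => dyadicCube d p.1 p.2 := by
  rintro ⟨_, k⟩ ⟨i, rfl, hk⟩ ⟨_, l⟩ ⟨j, rfl, hl⟩ hne
  refine Set.disjoint_left.2 fun x hxk hxl => ?_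
  have hxk' := ((mem_dyadicCube_iff (lt_of_mem_pickedCubes hk) x).1 hxk).2
  have hxl' := ((mem_dyadicCube_iff (lt_of_mem_pickedCubes hl) x).1 hxl).2
  dsimp only at hxk' hxl' hk hl
  subst hxk' hxl'
  rcases lt_trichotomy i j with h | rfl | h
  · exact idx_notMem_pickedCubes_of_lt h hk hl
  · exact hne rfl
  · exact idx_notMem_pickedCubes_of_lt h hl hk

lemma uncovered_subset_freeCubes (j : ℕ) :
    unitCube d \ ⋃ p ∈ greedyFamily d m, dyadicCube d p.1 p.2 ⊆
      ⋃ k ∈ freeCubes d m j, dyadicCube d j k := by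
  rintro x ⟨hx, hxu⟩
  have hfree : (fun i => dyadicIdx j (x i)) ∈ freeCubes d m j := by
    induction j with
    | zero =>
      simp only [freeCubes, Finset.mem_singleton]
      funext i
      simp [dyadicIdx]
    | succ j ih =>
      rw [freeCubes_succ, Finset.mem_sdiff, idx_mem_dyadicChildren]
      refine ⟨ih, fun h => hxu ?_⟩
      exact mem_iUnion₂_of_mem (i := (j + 1, fun i => dyadicIdx (j + 1) (x i))) ⟨j, rfl, h⟩
        ((mem_dyadicCube_iff (fun i => dyadicIdx_lt _ _) x).2 ⟨hx, rfl⟩)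
  exact mem_iUnion₂_of_mem hfree ((mem_dyadicCube_iff (fun i => dyadicIdx_lt _ _) x).2 ⟨hx, rfl⟩)

lemma card_freeCubes_succ_le (j : ℕ) :
    (freeCubes d m (j + 1)).card ≤ 2 ^ d * (freeCubes d m j).card - m (j + 1) := by
  rw [freeCubes_succ, Finset.card_sdiff_of_subset (pickedCubes_subset j), pickedCubes,
    card_takeUpTo]
  have := card_dyadicChildren_le j (freeCubes d m j)
  omega

lemma card_freeCubes_le (j : ℕ) :
    ((2 : ℝ≥0∞) ^ (d * j))⁻¹ * (freeCubes d m j).card ≤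
      1 - ∑ i ∈ Finset.range j, ((2 : ℝ≥0∞) ^ (d * (i + 1)))⁻¹ * m (i + 1) := by
  induction j with
  | zero => simp [freeCubes]
  | succ j ih =>
    have hc : ((freeCubes d m (j + 1)).card : ℝ≥0∞) ≤
        2 ^ d * (freeCubes d m j).card - m (j + 1) := by
      exact_mod_cast card_freeCubes_succ_le (d := d) (m := m) j
    have hne : ((2 : ℝ≥0∞) ^ (d * (j + 1)))⁻¹ ≠ ⊤ := by simp
    rw [Finset.sum_range_succ, ← tsub_tsub]
    calc ((2 : ℝ≥0∞) ^ (d * (j + 1)))⁻¹ * (freeCubes d m (j + 1)).card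
        ≤ ((2 : ℝ≥0∞) ^ (d * (j + 1)))⁻¹ * (2 ^ d * (freeCubes d m j).card - m (j + 1)) := by
          gcongr
      _ = ((2 : ℝ≥0∞) ^ (d * j))⁻¹ * (freeCubes d m j).card -
            ((2 : ℝ≥0∞) ^ (d * (j + 1)))⁻¹ * m (j + 1) := by
          rw [ENNReal.mul_sub fun _ _ => hne, ← mul_assoc]
          congr 2
          rw [mul_add, mul_one, pow_add, ENNReal.mul_inv (by simp) (by simp), mul_assoc,
            ENNReal.inv_mul_cancel (by simp) (by simp), mul_one]
      _ ≤ _ := tsub_le_tsub_right ih _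

lemma lamd_uncovered_greedyFamily
    (hm : 1 ≤ ∑' j : ℕ, ((2 : ℝ≥0∞) ^ (d * (j + 1)))⁻¹ * (m (j + 1) : ℝ≥0∞)) :
    lamd d (unitCube d \ ⋃ p ∈ greedyFamily d m, dyadicCube d p.1 p.2) = 0 := by
  set μ := lamd d (unitCube d \ ⋃ p ∈ greedyFamily d m, dyadicCube d p.1 p.2)
  have hμ : ∀ j, μ ≤ 1 - ∑ i ∈ Finset.range j, ((2 : ℝ≥0∞) ^ (d * (i + 1)))⁻¹ * m (i + 1) :=
    fun j => (measure_mono (uncovered_subset_freeCubes j)).trans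
      ((lamd_biUnion_dyadicCube_le _ _).trans (card_freeCubes_le j))
  by_contra hne
  have hle : ∑' j : ℕ, ((2 : ℝ≥0∞) ^ (d * (j + 1)))⁻¹ * (m (j + 1) : ℝ≥0∞) ≤ 1 - μ := by
    rw [ENNReal.tsum_eq_iSup_nat]
    refine iSup_le fun j => ?_
    have hpos : 0 < 1 - ∑ i ∈ Finset.range j, ((2 : ℝ≥0∞) ^ (d * (i + 1)))⁻¹ * m (i + 1) :=
      (pos_iff_ne_zero.2 hne).trans_le (hμ j)
    refine ENNReal.le_sub_of_add_le_left (measure_ne_top _ _) ?_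
    exact (add_le_add_left (hμ j) _).trans (tsub_add_cancel_of_le (tsub_pos_iff_lt.1 hpos).le).le
  exact (hm.trans hle).not_gt (ENNReal.sub_lt_self (by simp) (by simp) hne)

lemma encard_greedyFamily_level_le (j : ℕ) :
    (greedyFamily d m ∩ {p | p.1 = j}).encard ≤ m j := by
  cases j with
  | zero =>
    have : greedyFamily d m ∩ {p | p.1 = 0} = ∅ := by
      ext ⟨i, k⟩
      simp [greedyFamily]
      omega
    simp [this]
  | succ j =>
    have hsub : greedyFamily d m ∩ {p | p.1 = j + 1} ⊆
        Set.image (Prod.mk (j + 1)) (pickedCubes d m j) := by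
      rintro ⟨_, k⟩ ⟨⟨i, rfl, hk⟩, hi⟩
      obtain rfl : i = j := by simpa using hi
      exact ⟨k, hk, rfl⟩
    refine (encard_le_encard hsub).trans ((encard_image_le _ _).trans ?_)
    rw [encard_coe_eq_coe_finsetCard]
    exact_mod_cast (card_takeUpTo _ _).trans_le (min_le_left _ _)

end GreedySelection

lemma exists_memFw_of_one_le_tsum {d : ℕ} (hd : 1 ≤ d) {w : ℕ → ℝ} (hw : ∀ j, 0 ≤ w j)
    (hs : 1 ≤ ∑' j : ℕ, ((2 : ℝ≥0∞) ^ (d * (j + 1)))⁻¹ * (⌊w (j + 1)⌋₊ : ℝ≥0∞)) :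
    ∃ f, memFw d w f ∧ ∀ c : ℝ, ¬ (∀ᵐ x ∂(lamd d), f x = c) := by
  classical
  set T := greedyFamily d fun j => ⌊w j⌋₊
  have hcov : lamd d (unitCube d \ ⋃ p ∈ T, dyadicCube d p.1 p.2) = 0 :=
    lamd_uncovered_greedyFamily hs
  have hlt : ∀ p ∈ T, ∀ i, p.2 i < 2 ^ p.1 := by
    rintro ⟨_, k⟩ ⟨j, rfl, hk⟩
    exact lt_of_mem_pickedCubes hk
  obtain ⟨q, hq⟩ : T.Nonempty := by
    by_contra hne
    rw [Set.not_nonempty_iff_eq_empty] at hne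
    simp [hne, lamd_unitCube] at hcov
  set C := dyadicCube d q.1 q.2
  have hCmeas : MeasurableSet C := measurableSet_dyadicCube _ _
  have hCvol : lamd d C = ((2 : ℝ≥0∞) ^ (d * q.1))⁻¹ := lamd_dyadicCube (hlt q hq)
  have hq1 : q.1 ≠ 0 := by
    obtain ⟨j, hj, -⟩ := hq
    omega
  refine ⟨fun x => if x ∈ C then 1 else -1, ⟨?_, ?_, T, ⟨hlt, pairwiseDisjoint_greedyFamily, hcov,
    ?_⟩, fun j => ?_⟩, fun c hc => ?_⟩
  · exact Measurable.ite hCmeas measurable_const measurable_const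
  · intro x
    dsimp only
    split_ifs <;> simp
  · intro p hp x hx y hy
    by_cases hpq : p = q
    · subst hpq
      exact (if_pos hx).trans (if_pos hy).symm
    · have hdisj := pairwiseDisjoint_greedyFamily hp hq hpq
      exact (if_neg (Set.disjoint_left.1 hdisj hx)).trans
        (if_neg (Set.disjoint_left.1 hdisj hy)).symm
  · calc ((T ∩ {p | p.1 = j}).encard : ℝ≥0∞) ≤ ((⌊w j⌋₊ : ℕ∞) : ℝ≥0∞) :=
          ENat.toENNReal_le.2 (encard_greedyFamily_level_le j)
      _ = ENNReal.ofReal (⌊w j⌋₊ : ℝ) := by simp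
      _ ≤ ENNReal.ofReal (w j) := ENNReal.ofReal_le_ofReal (Nat.floor_le (hw j))
  · by_cases h1 : c = 1
    · have hone : lamd d C = 1 := by
        refine (mem_ae_iff_prob_eq_one hCmeas).1 ?_
        filter_upwards [hc] with x hx
        by_contra hxC
        rw [if_neg hxC, h1] at hx
        norm_num at hx
      rw [hCvol, ENNReal.inv_eq_one] at hone
      have : (2 : ℕ) ^ (d * q.1) = 1 := by exact_mod_cast hone
      rw [Nat.pow_eq_one] at this
      simp at this
      omega
    · have hzero : lamd d C = 0 := by
        refine measure_eq_zero_iff_ae_notMem.2 ?_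
        filter_upwards [hc] with x hx hxC
        rw [if_pos hxC] at hx
        exact h1 hx.symm
      simp [hCvol] at hzero

/-- `F_w^(d)` contains a non-a.e.-constant function if and only if
`∑_{j≥1} 2^{-dj} ⌊w(j)⌋ ≥ 1`. -/
theorem Fw_nontrivial_iff (d : ℕ) (hd : 1 ≤ d) (w : ℕ → ℝ) (hw : ∀ j, 0 ≤ w j)
    (hw0 : 1 ≤ w 0) :
    (∃ f, memFw d w f ∧ ∀ c : ℝ, ¬ (∀ᵐ x ∂(lamd d), f x = c)) ↔
      1 ≤ ∑' j : ℕ, ((2 : ℝ≥0∞) ^ (d * (j + 1)))⁻¹ * (⌊w (j + 1)⌋₊ : ℝ≥0∞) := by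
  exact ⟨fun ⟨_, hf, hnc⟩ => one_le_tsum_of_memFw hw hf hnc, exists_memFw_of_one_le_tsum hd hw⟩
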